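/- Let ψ: ℝ×ℝ → ℝ be continuously differentiable, let x = (x_1,…,x_N) ∈ ℝ^N, and let T be a continuously differentiable real-valued function defined on a neighborhood of x satisfying Σ_{n=1}^N ψ(y_n, T(y)) = 0 for every y in that neighborhood, with Σ_{n=1}^N ∂_θψ(x_n, T(x)) ≠ 0. Then the limit lim_{η→0+} (1/η)·sup{ |T(x+Δ) − T(x)| : Δ ∈ ℝ^N, max_{1≤n≤N} |Δ_n| ≤ η } exists and equals Σ_{n=1}^N |∂_xψ(x_n, T(x))| / |Σ_{n=1}^N ∂_θψ(x_n, T(x))|. -/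

import Mathlib

open Filter Topology

/-- The adversarial influence of a function that is differentiable at `x` is the norm of its
derivative, provided this norm `C` is attained at some `v₀` in the unit ball. -/
theorem tendsto_inv_mul_sSup_abs_sub {E : Type*} [NormedAddCommGroup E]
    [NormedSpace ℝ E] {f : E → ℝ} {L : E →L[ℝ] ℝ} {x v₀ : E} {C : ℝ} (hf : HasFDerivAt f L x)
    (hC : ∀ v, |L v| ≤ C * ‖v‖) (hC₀ : 0 ≤ C) (hv₀ : ‖v₀‖ ≤ 1) (hL : C ≤ |L v₀|) :
    Tendsto (fun η : ℝ => (1 / η) * sSup {r : ℝ | ∃ Δ : E, ‖Δ‖ ≤ η ∧ r = |f (x + Δ) - f x|})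
      (𝓝[>] 0) (𝓝 C) := by
  rw [Metric.tendsto_nhds]
  intro ε hε
  have hlin := (hasFDerivAt_iff_isLittleO_nhds_zero.1 hf).def (half_pos hε)
  obtain ⟨δ, hδ, hball⟩ := Metric.eventually_nhds_iff.1 hlin
  filter_upwards [Ioo_mem_nhdsGT hδ] with η ⟨hη, hηδ⟩
  have happrox : ∀ Δ : E, ‖Δ‖ ≤ η → |f (x + Δ) - f x - L Δ| ≤ ε / 2 * η := fun Δ hΔ => by
    have h := hball (y := Δ) (by rw [dist_zero_right]; linarith)
    rw [Real.norm_eq_abs] at h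
    exact h.trans (by gcongr)
  have hupper : ∀ r ∈ {r : ℝ | ∃ Δ : E, ‖Δ‖ ≤ η ∧ r = |f (x + Δ) - f x|},
      r ≤ (C + ε / 2) * η := by
    rintro r ⟨Δ, hΔ, rfl⟩
    have h₁ := happrox Δ hΔ
    have h₂ := hC Δ
    have h₃ : C * ‖Δ‖ ≤ C * η := by gcongr
    have h₄ := abs_sub_abs_le_abs_sub (f (x + Δ) - f x) (L Δ)
    linarith
  have hlower : (C - ε / 2) * η ≤
      sSup {r : ℝ | ∃ Δ : E, ‖Δ‖ ≤ η ∧ r = |f (x + Δ) - f x|} := by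
    have hΔ : ‖η • v₀‖ ≤ η := by
      rw [norm_smul, Real.norm_of_nonneg hη.le]
      exact mul_le_of_le_one_right hη.le hv₀
    refine le_trans ?_ (le_csSup ⟨_, hupper⟩ ⟨η • v₀, hΔ, rfl⟩)
    have h₁ := happrox _ hΔ
    have h₂ : |L (η • v₀)| = η * |L v₀| := by
      rw [map_smul, smul_eq_mul, abs_mul, abs_of_pos hη]
    have h₃ : η * C ≤ η * |L v₀| := by gcongr
    have h₄ := abs_sub_abs_le_abs_sub (L (η • v₀)) (f (x + η • v₀) - f x)
    rw [abs_sub_comm (L (η • v₀))] at h₄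
    linarith
  have hne : {r : ℝ | ∃ Δ : E, ‖Δ‖ ≤ η ∧ r = |f (x + Δ) - f x|}.Nonempty :=
    ⟨_, 0, by simpa using hη.le, rfl⟩
  have hsSup := csSup_le hne hupper
  rw [one_div_mul_eq_div, Real.dist_eq]
  have h₁ := (div_le_iff₀ hη).2 hsSup
  have h₂ := (le_div_iff₀ hη).2 hlower
  rw [abs_lt]
  constructor <;> linarith

theorem iSup_abs_le_iff_norm_le {ι : Type*} [Fintype ι] {v : ι → ℝ} {η : ℝ} (hη : 0 ≤ η) :
    (⨆ i, |v i|) ≤ η ↔ ‖v‖ ≤ η := by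
  rw [pi_norm_le_iff_of_nonneg hη]
  exact ⟨fun h i => (le_ciSup (Set.finite_range fun i => |v i|).bddAbove i).trans h,
    fun h => Real.iSup_le h hη⟩

/-- Implicit differentiation of the estimating equation of an M-estimator. -/
theorem sum_deriv_mul_add_eq_zero {ι : Type*} [Fintype ι] {ψ : ℝ → ℝ → ℝ}
    (hψ : Differentiable ℝ (Function.uncurry ψ)) {x : ι → ℝ} {T : (ι → ℝ) → ℝ}
    {L : (ι → ℝ) →L[ℝ] ℝ} (hT : HasFDerivAt T L x)
    (hEq : ∀ᶠ y in 𝓝 x, ∑ n, ψ (y n) (T y) = 0) (v : ι → ℝ) :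
    ∑ n, deriv (fun s => ψ s (T x)) (x n) * v n +
      (∑ n, deriv (fun t => ψ (x n) t) (T x)) * L v = 0 := by
  have hψ' := fun n => (hψ (x n, T x)).hasFDerivAt
  have hsum : HasFDerivAt (fun y : ι → ℝ => ∑ n, ψ (y n) (T y))
      (∑ n, (fderiv ℝ (Function.uncurry ψ) (x n, T x)).comp
        ((ContinuousLinearMap.proj n : (ι → ℝ) →L[ℝ] ℝ).prod L)) x :=
    HasFDerivAt.fun_sum fun n _ =>
      HasFDerivAt.comp (g := Function.uncurry ψ) x (hψ' n)
        ((ContinuousLinearMap.proj n : (ι → ℝ) →L[ℝ] ℝ).hasFDerivAt.prodMk hT)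
  have hzero := hsum.unique ((hasFDerivAt_const (0 : ℝ) x).congr_of_eventuallyEq hEq)
  have hx : ∀ n, deriv (fun s => ψ s (T x)) (x n) =
      fderiv ℝ (Function.uncurry ψ) (x n, T x) (1, 0) := fun n =>
    (HasFDerivAt.comp_hasDerivAt (l := Function.uncurry ψ) (x n) (hψ' n)
      ((hasDerivAt_id (x n)).prodMk (hasDerivAt_const (x n) (T x)))).deriv
  have hθ : ∀ n, deriv (fun t => ψ (x n) t) (T x) =
      fderiv ℝ (Function.uncurry ψ) (x n, T x) (0, 1) := fun n =>
    (HasFDerivAt.comp_hasDerivAt (l := Function.uncurry ψ) (T x) (hψ' n)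
      ((hasDerivAt_const (T x) (x n)).prodMk (hasDerivAt_id (T x)))).deriv
  have hv := DFunLike.congr_fun hzero v
  simp only [sum_apply, ContinuousLinearMap.comp_apply,
    ContinuousLinearMap.prod_apply, ContinuousLinearMap.proj_apply,
    zero_apply] at hv
  rw [← hv, Finset.sum_mul, ← Finset.sum_add_distrib]
  refine Finset.sum_congr rfl fun n _ => ?_
  have hsplit : (v n, L v) = v n • ((1, 0) : ℝ × ℝ) + L v • ((0, 1) : ℝ × ℝ) := by simp
  rw [hx, hθ, hsplit, map_add, map_smul, map_smul, smul_eq_mul, smul_eq_mul]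
  ring

/-- AIF of an M-estimator under the ℓ_∞ constraint. -/
theorem stmt_2 (N : ℕ) (hN : 0 < N) (ψ : ℝ → ℝ → ℝ)
    (hψ : ContDiff ℝ 1 (Function.uncurry ψ))
    (x : Fin N → ℝ) (T : (Fin N → ℝ) → ℝ) (U : Set (Fin N → ℝ))
    (hU : U ∈ 𝓝 x) (hT : ContDiffOn ℝ 1 T U)
    (hEq : ∀ y ∈ U, ∑ n, ψ (y n) (T y) = 0)
    (hD : (∑ n, deriv (fun t => ψ (x n) t) (T x)) ≠ 0) :
    Tendsto
      (fun η : ℝ => (1 / η) *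
        sSup {r : ℝ | ∃ Δ : Fin N → ℝ,
          (⨆ n : Fin N, |Δ n|) ≤ η ∧ r = |T (x + Δ) - T x|})
      (𝓝[>] (0 : ℝ))
      (𝓝 ((∑ n, |deriv (fun s => ψ s (T x)) (x n)|) /
        |∑ n, deriv (fun t => ψ (x n) t) (T x)|)) := by
  have hTx : HasFDerivAt T (fderiv ℝ T x) x :=
    ((hT.contDiffAt hU).differentiableAt one_ne_zero).hasFDerivAt
  have himplicit := sum_deriv_mul_add_eq_zero (hψ.differentiable one_ne_zero) hTx
    (Filter.eventually_of_mem hU hEq)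
  set a : Fin N → ℝ := fun n => deriv (fun s => ψ s (T x)) (x n)
  set D : ℝ := ∑ n, deriv (fun t => ψ (x n) t) (T x)
  have hL : ∀ v, |fderiv ℝ T x v| = |∑ n, a n * v n| / |D| := fun v => by
    rw [eq_div_iff (abs_ne_zero.2 hD), ← abs_mul, ← abs_neg (∑ n, a n * v n)]
    congr 1
    linarith [himplicit v]
  have hlim := tendsto_inv_mul_sSup_abs_sub hTx (C := (∑ n, |a n|) / |D|)
    (v₀ := fun n => (SignType.sign (a n) : ℝ)) ?_ (by positivity) ?_ ?_
  · refine hlim.congr' ?_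
    filter_upwards [self_mem_nhdsWithin] with η hη
    simp only [iSup_abs_le_iff_norm_le (le_of_lt hη)]
  · intro v
    rw [hL, div_mul_eq_mul_div, Finset.sum_mul]
    gcongr
    refine (Finset.abs_sum_le_sum_abs _ _).trans (Finset.sum_le_sum fun n _ => ?_)
    rw [abs_mul]
    gcongr
    exact norm_le_pi_norm v n
  · refine (pi_norm_le_iff_of_nonneg zero_le_one).2 fun n => ?_
    cases SignType.sign (a n) <;> simp
  · rw [hL]
    simp only [self_mul_sign]
    gcongr
    exact le_abs_self _
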